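/- One-way classical value upper bound for the Rademacher game: let T_{(x,z),y} = (1/M) ∑_{i,j=1}^n x_i z_j y_{i,j} for (x,z) ∈ {−1,1}^{2n}, y ∈ {−1,1}^{n²}, where M = ∑_{(x,z),y} |∑_{i,j} x_i z_j y_{i,j}|. Then for every k ≥ e², the supremum of |∑_{(x,z),y} ∑_{m=1}^k T_{(x,z),y} a((x,z),m) b(y,m)| over reals with ∑_m |a((x,z),m)| ≤ 1 for each (x,z) and |b(y,m)| ≤ 1 for all y,m, is at most (2√2 e² ln k)/n. -/

import Mathlib

open Finset

/-- The normalization constant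
`M = ∑_{(x,z) ∈ {−1,1}^{2n}} ∑_{y ∈ {−1,1}^{n²}} |∑_{i,j} x_i z_j y_{i,j}|`. -/
noncomputable def Mconst (n : ℕ) : ℝ :=
  ∑ x : Fin n → ℤˣ, ∑ z : Fin n → ℤˣ, ∑ y : Fin n → Fin n → ℤˣ,
    |∑ i, ∑ j, ((x i : ℤ) : ℝ) * ((z j : ℤ) : ℝ) * ((y i j : ℤ) : ℝ)|


lemma rg_units_sum (f : ℤˣ → ℝ) : ∑ e : ℤˣ, f e = f 1 + f (-1) := by
  rw [show (univ : Finset ℤˣ) = {1, -1} from by decide]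
  rw [Finset.sum_pair (by decide)]

lemma rg_card {ι : Type*} [Fintype ι] [DecidableEq ι] :
    (Fintype.card (ι → ℤˣ) : ℝ) = 2 ^ Fintype.card ι := by
  simp

lemma rg_fin_moments (m : ℕ) : ∀ u : Fin m → ℝ,
    (∑ x : Fin m → ℤˣ, (∑ i, ((x i : ℤ) : ℝ) * u i) ^ 2 = 2 ^ m * ∑ i, u i ^ 2) ∧
    (∑ x : Fin m → ℤˣ, (∑ i, ((x i : ℤ) : ℝ) * u i) ^ 4 ≤ 2 ^ m * (3 * (∑ i, u i ^ 2) ^ 2)) := by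
  induction m with
  | zero => intro u; simp
  | succ m ih =>
    intro u
    obtain ⟨h2, h4⟩ := ih (fun i => u i.succ)
    have key : ∀ g : ℝ → ℝ, ∑ x : Fin (m+1) → ℤˣ, g (∑ i, ((x i : ℤ) : ℝ) * u i)
        = ∑ x : Fin m → ℤˣ, (g (u 0 + ∑ i, ((x i : ℤ) : ℝ) * u i.succ)
            + g (-u 0 + ∑ i, ((x i : ℤ) : ℝ) * u i.succ)) := by
      intro g
      rw [← (Fin.consEquiv (fun _ : Fin (m+1) => ℤˣ)).sum_comp, Fintype.sum_prod_type, rg_units_sum,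
        ← Finset.sum_add_distrib]
      simp [Fin.sum_univ_succ, Fin.consEquiv]
    have hcard : ∑ x : Fin m → ℤˣ, (1 : ℝ) = 2 ^ m := by simp
    rw [key (fun t => t ^ 2), key (fun t => t ^ 4), Fin.sum_univ_succ]
    set s := ∑ i : Fin m, u i.succ ^ 2
    have hs : 0 ≤ s := by positivity
    constructor
    · have : ∀ x : Fin m → ℤˣ, (u 0 + ∑ i, ((x i : ℤ) : ℝ) * u i.succ) ^ 2
            + (-u 0 + ∑ i, ((x i : ℤ) : ℝ) * u i.succ) ^ 2
          = 2 * u 0 ^ 2 * 1 + 2 * (∑ i, ((x i : ℤ) : ℝ) * u i.succ) ^ 2 := by intro x; ring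
      rw [Finset.sum_congr rfl (fun x _ => this x), Finset.sum_add_distrib, ← Finset.mul_sum,
        ← Finset.mul_sum, h2, hcard]
      ring
    · have : ∀ x : Fin m → ℤˣ, (u 0 + ∑ i, ((x i : ℤ) : ℝ) * u i.succ) ^ 4
            + (-u 0 + ∑ i, ((x i : ℤ) : ℝ) * u i.succ) ^ 4
          = 2 * u 0 ^ 4 * 1 + 12 * u 0 ^ 2 * (∑ i, ((x i : ℤ) : ℝ) * u i.succ) ^ 2
            + 2 * (∑ i, ((x i : ℤ) : ℝ) * u i.succ) ^ 4 := by intro x; ring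
      rw [Finset.sum_congr rfl (fun x _ => this x), Finset.sum_add_distrib, Finset.sum_add_distrib,
        ← Finset.mul_sum, ← Finset.mul_sum, ← Finset.mul_sum, h2, hcard]
      have h5 : 0 ≤ (2 : ℝ) ^ m * u 0 ^ 4 := by positivity
      rw [pow_succ (2 : ℝ) m]
      nlinarith [h4, h5]

lemma rg_moments {ι : Type*} [Fintype ι] [DecidableEq ι] (u : ι → ℝ) :
    (∑ x : ι → ℤˣ, (∑ i, ((x i : ℤ) : ℝ) * u i) ^ 2 = 2 ^ Fintype.card ι * ∑ i, u i ^ 2) ∧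
    (∑ x : ι → ℤˣ, (∑ i, ((x i : ℤ) : ℝ) * u i) ^ 4
      ≤ 2 ^ Fintype.card ι * (3 * (∑ i, u i ^ 2) ^ 2)) := by
  let e := Fintype.equivFin ι
  have h := rg_fin_moments (Fintype.card ι) (fun i => u (e.symm i))
  have key : ∀ g : ℝ → ℝ, ∑ x : ι → ℤˣ, g (∑ i, ((x i : ℤ) : ℝ) * u i)
      = ∑ x : Fin (Fintype.card ι) → ℤˣ, g (∑ i, ((x i : ℤ) : ℝ) * u (e.symm i)) := by
    intro g
    rw [← (Equiv.arrowCongr e (Equiv.refl ℤˣ)).sum_comp]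
    refine Finset.sum_congr rfl fun x _ => ?_
    congr 1
    rw [← e.symm.sum_comp]
    simp [Equiv.arrowCongr]
  rw [key (fun t => t ^ 2), key (fun t => t ^ 4), ← e.symm.sum_comp (fun i => u i ^ 2)]
  exact h

lemma rg_exp_moment {ι : Type*} [Fintype ι] [DecidableEq ι] (u : ι → ℝ) :
    ∑ x : ι → ℤˣ, Real.exp (∑ i, ((x i : ℤ) : ℝ) * u i)
      ≤ 2 ^ Fintype.card ι * Real.exp ((∑ i, u i ^ 2) / 2) := by
  have h1 : ∑ x : ι → ℤˣ, Real.exp (∑ i, ((x i : ℤ) : ℝ) * u i)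
      = ∏ i, ∑ e : ℤˣ, Real.exp (((e : ℤ) : ℝ) * u i) := by
    rw [Finset.prod_univ_sum, Fintype.piFinset_univ]
    simp [Real.exp_sum]
  rw [h1]
  have h2 : ∀ i, ∑ e : ℤˣ, Real.exp (((e : ℤ) : ℝ) * u i) = 2 * Real.cosh (u i) := by
    intro i
    rw [rg_units_sum, Real.cosh_eq]; simp; ring
  simp only [h2]
  rw [Finset.prod_mul_distrib, Finset.sum_div, Real.exp_sum]
  simp only [prod_const, card_univ]
  gcongr with i
  exact Real.cosh_le_exp_half_sq _

lemma rg_cosh_moment {ι : Type*} [Fintype ι] [DecidableEq ι] (u : ι → ℝ) :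
    ∑ x : ι → ℤˣ, Real.cosh (∑ i, ((x i : ℤ) : ℝ) * u i)
      ≤ 2 ^ Fintype.card ι * Real.exp ((∑ i, u i ^ 2) / 2) := by
  have h1 := rg_exp_moment u
  have h2 := rg_exp_moment (fun i => - u i)
  simp only [mul_neg, Finset.sum_neg_distrib, neg_sq] at h2
  simp only [Real.cosh_eq, ← Finset.sum_div, Finset.sum_add_distrib]
  linarith

lemma rg_even_moment {ι : Type*} [Fintype ι] [DecidableEq ι] (u : ι → ℝ) (q : ℕ) (hq : 0 < q) :
    ∑ x : ι → ℤˣ, (∑ i, ((x i : ℤ) : ℝ) * u i) ^ (2 * q)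
      ≤ 2 ^ Fintype.card ι * ((Real.exp 1 * q) ^ q * (∑ i, u i ^ 2) ^ q) := by
  set s := ∑ i, u i ^ 2 with hs
  have hs0 : 0 ≤ s := by positivity
  rcases hs0.eq_or_lt with h0 | hpos
  · have : ∀ i, u i = 0 := by
      intro i
      have := (Finset.sum_eq_zero_iff_of_nonneg (fun i _ => sq_nonneg (u i))).1 (hs.symm.trans h0.symm) i (mem_univ i)
      simpa using this
    simp [this, hq.ne']
    positivity
  have hq' : (0:ℝ) < q := by exact_mod_cast hq
  obtain ⟨l, hl⟩ : ∃ l : ℝ, l ^ 2 = 2 * q / s :=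
    ⟨Real.sqrt (2 * q / s), Real.sq_sqrt (by positivity)⟩
  have hc := rg_cosh_moment (fun i => l * u i)
  have e1 : ∑ i, (l * u i) ^ 2 = 2 * q := by
    simp only [mul_pow, ← Finset.mul_sum, hl, ← hs]; field_simp
  rw [e1] at hc
  have hp : ∀ t : ℝ, t ^ (2 * q) ≤ (2 * q).factorial * Real.cosh t := by
    intro t
    have := le_hasSum (Real.hasSum_cosh t) q
      (fun j _ => by rw [pow_mul]; positivity)
    rw [div_le_iff₀ (by positivity)] at this
    linarith
  have h1 : (2 * q / s) ^ q * ∑ x : ι → ℤˣ, (∑ i, ((x i : ℤ) : ℝ) * u i) ^ (2 * q)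
      ≤ (2 * q).factorial * (2 ^ Fintype.card ι * Real.exp q) := by
    calc _ = ∑ x : ι → ℤˣ, (∑ i, ((x i : ℤ) : ℝ) * (l * u i)) ^ (2 * q) := by
          rw [Finset.mul_sum]
          refine Finset.sum_congr rfl fun x _ => ?_
          rw [← hl, ← pow_mul, ← mul_pow, Finset.mul_sum]
          congr 1
          refine Finset.sum_congr rfl fun i _ => by ring
      _ ≤ ∑ x : ι → ℤˣ, (2 * q).factorial * Real.cosh (∑ i, ((x i : ℤ) : ℝ) * (l * u i)) :=
          Finset.sum_le_sum fun x _ => hp _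
      _ ≤ _ := by
          rw [← Finset.mul_sum]
          gcongr
          rwa [mul_div_cancel_left₀ _ (two_ne_zero)] at hc
  have h2 : ((2 * q).factorial : ℝ) ≤ (2 * q) ^ q * (q : ℝ) ^ q := by
    have a1 := Nat.factorial_two_mul_le q
    have a2 := Nat.factorial_le_pow q
    have : (2 * q).factorial ≤ (2 * q) ^ q * q ^ q := a1.trans (by gcongr)
    exact_mod_cast this
  have h3 : (2 * q / s) ^ q * ∑ x : ι → ℤˣ, (∑ i, ((x i : ℤ) : ℝ) * u i) ^ (2 * q)
      ≤ (2 * q / s) ^ q * (2 ^ Fintype.card ι * ((Real.exp 1 * q) ^ q * s ^ q)) := by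
    refine h1.trans ?_
    have : (2 * q / s) ^ q * (2 ^ Fintype.card ι * ((Real.exp 1 * q) ^ q * s ^ q))
      = ((2 * q) ^ q * (q : ℝ) ^ q) * (2 ^ Fintype.card ι * Real.exp q) := by
      rw [← Real.exp_one_pow, div_pow, mul_pow (Real.exp 1)]
      field_simp
    rw [this]
    gcongr
  exact le_of_mul_le_mul_left h3 (by positivity)

lemma rg_chaos (n : ℕ) (c : Fin n → Fin n → ℝ) (q : ℕ) (hq : 0 < q)
    (hc : ∑ i, ∑ j, c i j ^ 2 ≤ 1) :
    ∑ x : Fin n → ℤˣ, ∑ z : Fin n → ℤˣ,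
      (∑ i, ((x i : ℤ) : ℝ) * ∑ j, ((z j : ℤ) : ℝ) * c i j) ^ (2 * q)
      ≤ 2 ^ n * 2 ^ n * (Real.exp 1 * q) ^ (2 * q) := by
  set D := (Real.exp 1 * q) ^ q with hD
  have hD0 : 0 ≤ D := by positivity
  set w : Fin n → ℝ := fun i => ∑ j, c i j ^ 2 with hw
  have hw0 : ∀ i, 0 ≤ w i := fun i => by positivity
  set S := ∑ i, w i with hS
  have hS0 : 0 ≤ S := Finset.sum_nonneg fun i _ => hw0 i
  have hzero : ∀ i, w i = 0 → ∀ j, c i j = 0 := by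
    intro i hi j
    have := (Finset.sum_eq_zero_iff_of_nonneg (fun j _ => sq_nonneg (c i j))).1 hi j (mem_univ j)
    simpa using this
  have hz : ∑ z : Fin n → ℤˣ, (∑ i, (∑ j, ((z j : ℤ) : ℝ) * c i j) ^ 2) ^ q ≤ 2 ^ n * D := by
    rcases hS0.eq_or_lt with h0 | hpos
    · have hwz : ∀ i, w i = 0 := fun i =>
        (Finset.sum_eq_zero_iff_of_nonneg (fun i _ => hw0 i)).1 (hS.symm.trans h0.symm) i (mem_univ i)
      have : ∀ i j, c i j = 0 := fun i => hzero i (hwz i)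
      simp [this, hq.ne']
      positivity
    calc _ ≤ ∑ z : Fin n → ℤˣ, ∑ i, (w i / S) * (S * (∑ j, ((z j : ℤ) : ℝ) * c i j) ^ 2 / w i) ^ q := by
          refine Finset.sum_le_sum fun z _ => ?_
          have := Real.pow_arith_mean_le_arith_mean_pow univ (fun i => w i / S)
            (fun i => S * (∑ j, ((z j : ℤ) : ℝ) * c i j) ^ 2 / w i)
            (fun i _ => div_nonneg (hw0 i) hS0) (by rw [← Finset.sum_div]; exact div_self hpos.ne')
            (fun i _ => div_nonneg (by positivity) (hw0 i)) q
          refine le_trans (le_of_eq ?_) this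
          congr 1
          refine Finset.sum_congr rfl fun i _ => ?_
          by_cases h : w i = 0
          · simp [hzero i h]
          · field_simp
      _ = ∑ i, (w i / S) * ((S / w i) ^ q * ∑ z : Fin n → ℤˣ, (∑ j, ((z j : ℤ) : ℝ) * c i j) ^ (2 * q)) := by
          rw [Finset.sum_comm]
          refine Finset.sum_congr rfl fun i _ => ?_
          rw [← Finset.mul_sum, Finset.mul_sum _ _ ((S / w i) ^ q)]
          congr 1
          refine Finset.sum_congr rfl fun z _ => ?_
          rw [pow_mul, ← mul_pow]; congr 1; ring
      _ ≤ ∑ i, (w i / S) * (S ^ q * (2 ^ n * D)) := by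
          refine Finset.sum_le_sum fun i _ => ?_
          refine mul_le_mul_of_nonneg_left ?_ (div_nonneg (hw0 i) hS0)
          by_cases h : w i = 0
          · simp [h, hq.ne']; positivity
          have hwp : 0 < w i := lt_of_le_of_ne (hw0 i) (Ne.symm h)
          have := rg_even_moment (c i) q hq
          rw [Fintype.card_fin] at this
          calc _ ≤ (S / w i) ^ q * (2 ^ n * (D * (w i) ^ q)) := by
                gcongr
            _ = _ := by rw [div_pow]; field_simp
      _ = S ^ q * (2 ^ n * D) := by
          rw [← Finset.sum_mul, ← Finset.sum_div, div_self hpos.ne', one_mul]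
      _ ≤ 1 * (2 ^ n * D) := by
          gcongr
          exact pow_le_one₀ hS0 hc
      _ = _ := one_mul _
  rw [Finset.sum_comm]
  calc _ ≤ ∑ z : Fin n → ℤˣ, 2 ^ n * (D * (∑ i, (∑ j, ((z j : ℤ) : ℝ) * c i j) ^ 2) ^ q) := by
        refine Finset.sum_le_sum fun z _ => ?_
        have := rg_even_moment (fun i => ∑ j, ((z j : ℤ) : ℝ) * c i j) q hq
        rwa [Fintype.card_fin] at this
    _ ≤ 2 ^ n * (D * (2 ^ n * D)) := by
        rw [← Finset.mul_sum, ← Finset.mul_sum]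
        gcongr
    _ = _ := by rw [hD, two_mul, pow_add]; ring

lemma rg_curry (n : ℕ) (u : Fin n → Fin n → ℝ) (g : ℝ → ℝ) :
    ∑ y : Fin n → Fin n → ℤˣ, g (∑ i, ∑ j, ((y i j : ℤ) : ℝ) * u i j)
      = ∑ y : Fin n × Fin n → ℤˣ, g (∑ p, ((y p : ℤ) : ℝ) * u p.1 p.2) := by
  rw [← (Equiv.curry (Fin n) (Fin n) ℤˣ).sum_comp]
  refine Finset.sum_congr rfl fun y _ => ?_
  rw [Fintype.sum_prod_type]
  rfl

lemma rg_moments2 (n : ℕ) (u : Fin n → Fin n → ℝ) :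
    (∑ y : Fin n → Fin n → ℤˣ, (∑ i, ∑ j, ((y i j : ℤ) : ℝ) * u i j) ^ 2
      = 2 ^ (n * n) * ∑ i, ∑ j, u i j ^ 2) ∧
    (∑ y : Fin n → Fin n → ℤˣ, (∑ i, ∑ j, ((y i j : ℤ) : ℝ) * u i j) ^ 4
      ≤ 2 ^ (n * n) * (3 * (∑ i, ∑ j, u i j ^ 2) ^ 2)) := by
  have h := rg_moments (fun p : Fin n × Fin n => u p.1 p.2)
  rw [rg_curry n u (fun t => t ^ 2), rg_curry n u (fun t => t ^ 4)]
  rw [Fintype.sum_prod_type (f := fun p : Fin n × Fin n => u p.1 p.2 ^ 2)] at h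
  simpa only [Fintype.card_prod, Fintype.card_fin] using h

lemma rg_card2 (n : ℕ) : ∑ _y : Fin n → Fin n → ℤˣ, (1 : ℝ) = 2 ^ (n * n) := by
  simp [pow_mul]

lemma rg_unit_sq (e : ℤˣ) : ((e : ℤ) : ℝ) ^ 2 = 1 := by
  rcases Int.units_eq_one_or e with h | h <;> simp [h]

lemma rg_abs_lower (n : ℕ) (hn : 0 < n) (x z : Fin n → ℤˣ) :
    5 / 9 * n * 2 ^ (n * n) ≤ ∑ y : Fin n → Fin n → ℤˣ,
      |∑ i, ∑ j, ((x i : ℤ) : ℝ) * ((z j : ℤ) : ℝ) * ((y i j : ℤ) : ℝ)| := by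
  have hn' : (0 : ℝ) < n := by exact_mod_cast hn
  obtain ⟨h2, h4⟩ := rg_moments2 n (fun i j => ((x i : ℤ) : ℝ) * ((z j : ℤ) : ℝ))
  have hu : ∑ i : Fin n, ∑ j : Fin n, (((x i : ℤ) : ℝ) * ((z j : ℤ) : ℝ)) ^ 2 = (n : ℝ) ^ 2 := by
    simp only [mul_pow, rg_unit_sq]
    simp [sq]
  rw [hu] at h2 h4
  have hpt : ∀ s : ℝ, 27 * n * s ^ 2 * n ^ 2 - 4 * n * s ^ 4 ≤ 27 * n ^ 4 * |s| := by
    intro s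
    have e2 : s ^ 2 = |s| ^ 2 := (sq_abs s).symm
    have e4 : s ^ 4 = |s| ^ 4 := by rw [show s ^ 4 = (s ^ 2) ^ 2 by ring, e2]; ring
    rw [e2, e4]
    have hs := abs_nonneg s
    have : 0 ≤ n * |s| * ((2 * |s| - 3 * n) ^ 2 * (|s| + 3 * n)) := by positivity
    nlinarith [this]
  have hsum := Finset.sum_le_sum (s := (univ : Finset (Fin n → Fin n → ℤˣ))) fun y _ =>
    hpt (∑ i, ∑ j, ((y i j : ℤ) : ℝ) * (((x i : ℤ) : ℝ) * ((z j : ℤ) : ℝ)))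
  rw [Finset.sum_sub_distrib, ← Finset.mul_sum, ← Finset.sum_mul, ← Finset.mul_sum,
    ← Finset.mul_sum, h2] at hsum
  have hcomm : ∀ y : Fin n → Fin n → ℤˣ,
      ∑ i, ∑ j, ((x i : ℤ) : ℝ) * ((z j : ℤ) : ℝ) * ((y i j : ℤ) : ℝ)
      = ∑ i, ∑ j, ((y i j : ℤ) : ℝ) * (((x i : ℤ) : ℝ) * ((z j : ℤ) : ℝ)) := fun y =>
    Finset.sum_congr rfl fun i _ => Finset.sum_congr rfl fun j _ => by ring
  simp only [hcomm]
  have h5 := mul_le_mul_of_nonneg_left h4 hn'.le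
  refine le_of_mul_le_mul_left (a := 27 * (n : ℝ) ^ 4) ?_ (by positivity)
  refine le_trans ?_ hsum
  nlinarith [h5]

lemma rg_M_lower (n : ℕ) (hn : 0 < n) :
    2 ^ n * 2 ^ n * (5 / 9 * n * 2 ^ (n * n)) ≤ Mconst n := by
  unfold Mconst
  calc _ = ∑ x : Fin n → ℤˣ, ∑ z : Fin n → ℤˣ, (5 / 9 * n * 2 ^ (n * n) : ℝ) := by
        simp; ring
    _ ≤ _ := Finset.sum_le_sum fun x _ => Finset.sum_le_sum fun z _ => rg_abs_lower n hn x z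

lemma rg_bessel (n : ℕ) (b : (Fin n → Fin n → ℤˣ) → ℝ) (hb : ∀ y, |b y| ≤ 1) :
    ∑ i, ∑ j, ((∑ y : Fin n → Fin n → ℤˣ, ((y i j : ℤ) : ℝ) * b y) / 2 ^ (n * n)) ^ 2 ≤ 1 := by
  set c : Fin n → Fin n → ℝ :=
    fun i j => (∑ y : Fin n → Fin n → ℤˣ, ((y i j : ℤ) : ℝ) * b y) / 2 ^ (n * n) with hc
  have h2 := (rg_moments2 n c).1
  change ∑ i, ∑ j, c i j ^ 2 ≤ 1
  set S := ∑ i, ∑ j, c i j ^ 2 with hS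
  have h1 : ∑ y : Fin n → Fin n → ℤˣ, b y * (∑ i, ∑ j, ((y i j : ℤ) : ℝ) * c i j)
      = 2 ^ (n * n) * S := by
    simp only [Finset.mul_sum, hS]
    rw [Finset.sum_comm]
    refine Finset.sum_congr rfl fun i _ => ?_
    rw [Finset.sum_comm]
    refine Finset.sum_congr rfl fun j _ => ?_
    have : ∑ y : Fin n → Fin n → ℤˣ, ((y i j : ℤ) : ℝ) * b y = 2 ^ (n * n) * c i j := by
      rw [hc]; field_simp
    rw [sq, ← mul_assoc, ← this, Finset.sum_mul]
    exact Finset.sum_congr rfl fun y _ => by ring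
  have h3 : 0 ≤ ∑ y : Fin n → Fin n → ℤˣ,
      (1 - 2 * (b y * (∑ i, ∑ j, ((y i j : ℤ) : ℝ) * c i j))
        + (∑ i, ∑ j, ((y i j : ℤ) : ℝ) * c i j) ^ 2) := by
    refine Finset.sum_nonneg fun y _ => ?_
    have := (sq_le_one_iff_abs_le_one (b y)).2 (hb y)
    nlinarith [sq_nonneg (b y - ∑ i, ∑ j, ((y i j : ℤ) : ℝ) * c i j)]
  rw [Finset.sum_add_distrib, Finset.sum_sub_distrib, ← Finset.mul_sum, h1, h2, rg_card2] at h3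
  have hp : (0 : ℝ) < 2 ^ (n * n) := by positivity
  refine le_of_mul_le_mul_left (a := (2 : ℝ) ^ (n * n)) ?_ hp
  linarith

lemma rg_max_bound {X : Type*} [Fintype X] (k p : ℕ) (hp : 0 < p) (hkp : (k : ℝ) ≤ Real.exp 1 ^ p)
    (R N : ℝ) (hR : 0 < R) (hN : Fintype.card X = N)
    (a Q : X → Fin k → ℝ) (ha : ∀ x, ∑ m, |a x m| ≤ 1)
    (hQ : ∀ m, ∑ x, |Q x m| ^ p ≤ N * R ^ p) :
    |∑ x, ∑ m, a x m * Q x m| ≤ N * (Real.exp 1 * R) := by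
  set A := Real.exp 1 * R with hA
  have hA0 : 0 < A := by positivity
  have hp' : (1 : ℝ) ≤ p := by exact_mod_cast hp
  have hpt : ∀ t : ℝ, 0 ≤ t → p * t ≤ A * (p - 1) + A * (t ^ p / A ^ p) := by
    intro t ht
    have h := one_add_mul_le_pow (a := t / A - 1) (by
      have : 0 ≤ t / A := by positivity
      linarith) p
    rw [show 1 + (t / A - 1) = t / A by ring, div_pow] at h
    have h' := mul_le_mul_of_nonneg_left h hA0.le
    have : A * (1 + p * (t / A - 1)) = A - p * A + p * t := by field_simp; ring
    linarith
  have h1 : ∀ x, p * ∑ m, |a x m| * |Q x m| ≤ A * (p - 1) + A * ∑ m, |Q x m| ^ p / A ^ p := by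
    intro x
    calc p * ∑ m, |a x m| * |Q x m| = ∑ m, |a x m| * (p * |Q x m|) := by
          rw [Finset.mul_sum]; exact Finset.sum_congr rfl fun m _ => by ring
      _ ≤ ∑ m, (|a x m| * (A * (p - 1)) + A * (|Q x m| ^ p / A ^ p)) := by
          refine Finset.sum_le_sum fun m _ => ?_
          have e1 := mul_le_mul_of_nonneg_left (hpt |Q x m| (abs_nonneg _)) (abs_nonneg (a x m))
          have e2 : |a x m| ≤ 1 :=
            (Finset.single_le_sum (f := fun m => |a x m|) (fun m _ => abs_nonneg _) (mem_univ m)).trans (ha x)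
          have e3 : 0 ≤ A * (|Q x m| ^ p / A ^ p) := by positivity
          nlinarith [mul_le_mul_of_nonneg_right e2 e3]
      _ ≤ _ := by
          rw [Finset.sum_add_distrib, ← Finset.sum_mul, ← Finset.mul_sum]
          have : 0 ≤ A * ((p : ℝ) - 1) := mul_nonneg hA0.le (by linarith)
          nlinarith [mul_le_mul_of_nonneg_right (ha x) this]
  have hN0 : 0 ≤ N := by rw [← hN]; positivity
  have h2 : ∑ x, ∑ m, |Q x m| ^ p / A ^ p ≤ N := by
    rw [Finset.sum_comm]
    calc _ ≤ ∑ m : Fin k, N * R ^ p / A ^ p := by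
          refine Finset.sum_le_sum fun m _ => ?_
          rw [← Finset.sum_div]
          gcongr
          exact hQ m
      _ = N * (k / Real.exp 1 ^ p) := by
          simp [hA, mul_pow]; field_simp
      _ ≤ N * 1 := by
          gcongr
          exact div_le_one_of_le₀ hkp (by positivity)
      _ = N := mul_one N
  have h3 : p * ∑ x, ∑ m, |a x m| * |Q x m| ≤ p * (N * A) := by
    calc _ ≤ ∑ x, (A * (p - 1) + A * ∑ m, |Q x m| ^ p / A ^ p) := by
          rw [Finset.mul_sum]; exact Finset.sum_le_sum fun x _ => h1 x
      _ = N * (A * (p - 1)) + A * ∑ x, ∑ m, |Q x m| ^ p / A ^ p := by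
          rw [Finset.sum_add_distrib, Finset.sum_const, nsmul_eq_mul, ← Finset.mul_sum univ _ A,
            Finset.card_univ, hN]
      _ ≤ N * (A * (p - 1)) + A * N := by gcongr
      _ = _ := by ring
  refine le_trans ?_ (le_of_mul_le_mul_left h3 (by linarith))
  refine (Finset.abs_sum_le_sum_abs _ _).trans (Finset.sum_le_sum fun x _ => ?_)
  refine (Finset.abs_sum_le_sum_abs _ _).trans (Finset.sum_le_sum fun m _ => ?_)
  rw [abs_mul]

/-- One-way classical value upper bound for the Rademacher game: with
coefficients `T_{(x,z),y} = (1/M) ∑_{i,j} x_i z_j y_{i,j}`, for every `k ≥ e²`,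
every one-way classical strategy with `k` messages — reals `a((x,z),m)` with
`∑_m |a((x,z),m)| ≤ 1` and `b(y,m)` with `|b(y,m)| ≤ 1` — satisfies
`|∑_{(x,z),y,m} T_{(x,z),y} a((x,z),m) b(y,m)| ≤ 2√2 e² ln(k)/n`. -/
theorem one_way_classical_value_rademacher_game_upper
    (n k : ℕ) (hn : 0 < n) (hk : Real.exp 1 ^ 2 ≤ (k : ℝ))
    (a : ((Fin n → ℤˣ) × (Fin n → ℤˣ)) → Fin k → ℝ)
    (b : (Fin n → Fin n → ℤˣ) → Fin k → ℝ)
    (ha : ∀ xz, ∑ m, |a xz m| ≤ 1) (hb : ∀ y m, |b y m| ≤ 1) :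
    |∑ xz : (Fin n → ℤˣ) × (Fin n → ℤˣ), ∑ y : Fin n → Fin n → ℤˣ, ∑ m : Fin k,
        ((∑ i, ∑ j, ((xz.1 i : ℤ) : ℝ) * ((xz.2 j : ℤ) : ℝ) * ((y i j : ℤ) : ℝ))
            / Mconst n) * a xz m * b y m|
      ≤ 2 * Real.sqrt 2 * Real.exp 1 ^ 2 * Real.log k / n := by
  have hn' : (0 : ℝ) < n := by exact_mod_cast hn
  have hkpos : (0 : ℝ) < k := lt_of_lt_of_le (by positivity) hk
  have hL : 2 ≤ Real.log k := by
    rw [Real.le_log_iff_exp_le hkpos]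
    refine le_trans (le_of_eq ?_) hk
    rw [Real.exp_one_pow]; norm_num
  set q := ⌈Real.log k / 2⌉₊ with hq
  have hq0 : 0 < q := Nat.ceil_pos.2 (by linarith)
  have hq0' : (0 : ℝ) < q := by exact_mod_cast hq0
  have hq1 : Real.log k / 2 ≤ q := Nat.le_ceil _
  have hq2 : (q : ℝ) < Real.log k / 2 + 1 := Nat.ceil_lt_add_one (by linarith)
  have hkp : (k : ℝ) ≤ Real.exp 1 ^ (2 * q) := by
    rw [Real.exp_one_pow, ← Real.log_le_iff_le_exp hkpos]
    push_cast; linarith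
  set c : Fin k → Fin n → Fin n → ℝ := fun m i j =>
    (∑ y : Fin n → Fin n → ℤˣ, ((y i j : ℤ) : ℝ) * b y m) / 2 ^ (n * n) with hc
  set Q : (Fin n → ℤˣ) × (Fin n → ℤˣ) → Fin k → ℝ := fun xz m =>
    ∑ i, ((xz.1 i : ℤ) : ℝ) * ∑ j, ((xz.2 j : ℤ) : ℝ) * c m i j with hQ
  have hmain := rg_max_bound k (2 * q) (by omega) hkp (Real.exp 1 * q) (2 ^ n * 2 ^ n)
    (by positivity) (by simp) a Q ha (by
      intro m
      have := rg_chaos n (c m) q hq0 (rg_bessel n (fun y => b y m) (fun y => hb y m))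
      rw [Fintype.sum_prod_type]
      refine le_trans (le_of_eq ?_) this
      refine Finset.sum_congr rfl fun x _ => Finset.sum_congr rfl fun z _ => ?_
      rw [pow_mul, sq_abs, ← pow_mul])
  have hM := rg_M_lower n hn
  have hMpos : 0 < Mconst n := lt_of_lt_of_le (by positivity) hM
  have heq : ∑ xz : (Fin n → ℤˣ) × (Fin n → ℤˣ), ∑ y : Fin n → Fin n → ℤˣ, ∑ m : Fin k,
        ((∑ i, ∑ j, ((xz.1 i : ℤ) : ℝ) * ((xz.2 j : ℤ) : ℝ) * ((y i j : ℤ) : ℝ))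
            / Mconst n) * a xz m * b y m
      = 2 ^ (n * n) / Mconst n * ∑ xz, ∑ m, a xz m * Q xz m := by
    rw [Finset.mul_sum]
    refine Finset.sum_congr rfl fun xz _ => ?_
    rw [Finset.sum_comm, Finset.mul_sum]
    refine Finset.sum_congr rfl fun m _ => ?_
    have hQe : 2 ^ (n * n) * Q xz m = ∑ y : Fin n → Fin n → ℤˣ,
        (∑ i, ∑ j, ((xz.1 i : ℤ) : ℝ) * ((xz.2 j : ℤ) : ℝ) * ((y i j : ℤ) : ℝ)) * b y m := by
      simp only [hQ, Finset.mul_sum, Finset.sum_mul]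
      symm
      rw [Finset.sum_comm]
      refine Finset.sum_congr rfl fun i _ => ?_
      rw [Finset.sum_comm]
      refine Finset.sum_congr rfl fun j _ => ?_
      have : ∑ y : Fin n → Fin n → ℤˣ, ((y i j : ℤ) : ℝ) * b y m = 2 ^ (n * n) * c m i j := by
        rw [hc]; field_simp
      rw [show (2 : ℝ) ^ (n * n) * (((xz.1 i : ℤ) : ℝ) * (((xz.2 j : ℤ) : ℝ) * c m i j))
        = ((xz.1 i : ℤ) : ℝ) * ((xz.2 j : ℤ) : ℝ) * (2 ^ (n * n) * c m i j) by ring, ← this,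
        Finset.mul_sum]
      exact Finset.sum_congr rfl fun y _ => by ring
    rw [show 2 ^ (n * n) / Mconst n * (a xz m * Q xz m)
      = (a xz m / Mconst n) * (2 ^ (n * n) * Q xz m) by ring, hQe, Finset.mul_sum]
    exact Finset.sum_congr rfl fun y _ => by ring
  rw [heq, abs_mul, abs_of_pos (by positivity)]
  have hs2 : (1 : ℝ) ≤ Real.sqrt 2 := by rw [Real.one_le_sqrt]; norm_num
  calc _ ≤ 2 ^ (n * n) / Mconst n * (2 ^ n * 2 ^ n * (Real.exp 1 * (Real.exp 1 * q))) := by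
        gcongr
    _ ≤ 2 ^ (n * n) / (2 ^ n * 2 ^ n * (5 / 9 * n * 2 ^ (n * n)))
          * (2 ^ n * 2 ^ n * (Real.exp 1 * (Real.exp 1 * q))) := by
        gcongr
    _ = (9 / 5 * q) * Real.exp 1 ^ 2 / n := by field_simp
    _ ≤ _ := by
        refine div_le_div_of_nonneg_right ?_ hn'.le
        have h6 : 9 / 5 * (q : ℝ) ≤ 2 * 1 * Real.log k := by linarith
        have h7 : 2 * 1 * Real.log k ≤ 2 * Real.sqrt 2 * Real.log k := by gcongr
        have h8 : (0 : ℝ) ≤ Real.exp 1 ^ 2 := by positivity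
        nlinarith [mul_le_mul_of_nonneg_right (h6.trans h7) h8]
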